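/- Let K be a field with char(K) ≠ 3, let f = X³ − d be an irreducible polynomial over K, let α be a root of f, and let L = K(α). Then T₀·T₁ = L; that is, every element of L can be written as a product x·y with x, y ∈ L, Tr(x) = 0 and Tr(y) = 1. -/

import Mathlib

open Polynomial

theorem three_ne_zero_of_ringChar_ne_three {K : Type*} [Field K] (hchar : ringChar K ≠ 3) :
    (3 : K) ≠ 0 := by
  intro h
  have hdvd : ringChar K ∣ 3 := ringChar.dvd (by exact_mod_cast h)
  rcases (Nat.dvd_prime Nat.prime_three).1 hdvd with h1 | h3
  · exact CharP.ringChar_ne_one h1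
  · exact hchar h3

section PureCubic

variable {K L : Type*} [Field K] [Field L] [Algebra K L] {d : K} {α : L}

theorem exists_basis_pow_of_pureCubic (hirr : Irreducible (X ^ 3 - C d : K[X]))
    (hroot : Polynomial.aeval α (X ^ 3 - C d : K[X]) = 0)
    (hgen : Algebra.adjoin K {α} = ⊤) :
    ∃ b : Module.Basis (Fin 3) K L, ∀ i, b i = α ^ (i : ℕ) := by
  have hmonic : (X ^ 3 - C d : K[X]).Monic := monic_X_pow_sub_C d three_ne_zero
  have hmin := minpoly.eq_of_irreducible_of_monic hirr hroot hmonic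
  have hint : IsIntegral K α := ⟨_, hmonic, hroot⟩
  let pb := PowerBasis.ofAdjoinEqTop hint hgen
  have hdim : pb.dim = 3 := by
    rw [PowerBasis.ofAdjoinEqTop_dim, ← hmin, natDegree_X_pow_sub_C]
  refine ⟨pb.basis.reindex (finCongr hdim), fun i => ?_⟩
  rw [Module.Basis.reindex_apply, pb.basis_eq_pow, PowerBasis.ofAdjoinEqTop_gen]
  rfl

theorem trace_pureCubic (b : Module.Basis (Fin 3) K L) (hb : ∀ i, b i = α ^ (i : ℕ))
    (hα : α ^ 3 = algebraMap K L d) (p q r : K) :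
    Algebra.trace K L (algebraMap K L p + algebraMap K L q * α + algebraMap K L r * α ^ 2)
      = 3 * p := by
  have h0 : b 0 = 1 := by simp [hb]
  have h1 : b 1 = α := by simp [hb]
  have h2 : b 2 = α ^ 2 := by simp [hb]
  have e0 : (algebraMap K L p + algebraMap K L q * α + algebraMap K L r * α ^ 2) * b 0
      = p • b 0 + q • b 1 + r • b 2 := by
    simp only [h0, h1, h2, Algebra.smul_def]; ring
  have e1 : (algebraMap K L p + algebraMap K L q * α + algebraMap K L r * α ^ 2) * b 1
      = (r * d) • b 0 + p • b 1 + q • b 2 := by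
    simp only [h0, h1, h2, Algebra.smul_def, map_mul, ← hα]; ring
  have e2 : (algebraMap K L p + algebraMap K L q * α + algebraMap K L r * α ^ 2) * b 2
      = (q * d) • b 0 + (r * d) • b 1 + p • b 2 := by
    simp only [h0, h1, h2, Algebra.smul_def, map_mul, ← hα]; ring
  rw [Algebra.trace_eq_matrix_trace b, Matrix.trace, Fin.sum_univ_three]
  simp only [Matrix.diag_apply, Algebra.leftMulMatrix_eq_repr_mul, e0, e1, e2]
  simp
  ring

end PureCubic

/-- For a cubic extension L = K(α), char K ≠ 3, α a root of the irreducible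
polynomial X³ − d: T₀·T₁ = L. -/
theorem stmt_9 (K L : Type*) [Field K] [Field L] [Algebra K L] [FiniteDimensional K L]
    (hchar : ringChar K ≠ 3) (d : K)
    (hirr : Irreducible (X ^ 3 - C d : K[X]))
    (α : L) (hroot : Polynomial.aeval α (X ^ 3 - C d : K[X]) = 0)
    (hgen : Algebra.adjoin K {α} = ⊤) :
    ∀ β : L, ∃ x y : L,
      Algebra.trace K L x = 0 ∧ Algebra.trace K L y = 1 ∧ β = x * y := by
  intro β
  have h3 : (3 : K) ≠ 0 := three_ne_zero_of_ringChar_ne_three hchar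
  have hd : d ≠ 0 := fun h =>
    pow_ne_of_irreducible_X_pow_sub_C hirr dvd_rfl (by decide) 0 (by simp [h])
  have hd1 : 1 + d ≠ 0 := fun h =>
    pow_ne_of_irreducible_X_pow_sub_C hirr dvd_rfl (by decide) (-1) (by linear_combination -h)
  have hα : α ^ 3 = algebraMap K L d := by simpa [sub_eq_zero] using hroot
  obtain ⟨e, he⟩ := exists_basis_pow_of_pureCubic hirr hroot hgen
  have htr := trace_pureCubic e he hα
  obtain ⟨a, b, c, rfl⟩ : ∃ a b c : K,
      β = algebraMap K L a + algebraMap K L b * α + algebraMap K L c * α ^ 2 := by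
    refine ⟨e.repr β 0, e.repr β 1, e.repr β 2, ?_⟩
    conv_lhs => rw [← e.sum_repr β, Fin.sum_univ_three]
    simp [he, Algebra.smul_def]
  -- It suffices to give the coordinates of the two factors in the basis `1, α, α ^ 2`.
  suffices h : ∃ q r s t u : K, 3 * s = 1 ∧ a = d * (q * u + r * t) ∧ b = q * s + d * (r * u) ∧
      c = q * t + r * s by
    obtain ⟨q, r, s, t, u, hs, rfl, rfl, rfl⟩ := h
    refine ⟨_, _, (htr 0 q r).trans (mul_zero 3), (htr s t u).trans hs, ?_⟩
    simp only [map_add, map_mul, map_zero, ← hα]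
    ring
  by_cases hb : b = 0
  · by_cases hc : c = 0
    · refine ⟨-3 * a / (1 + d), -3 * a / (1 + d), 1 / 3, -1 / 3, -1 / (3 * d), ?_, ?_, ?_, ?_⟩ <;>
        subst hb hc <;> field_simp <;> ring
    · refine ⟨0, 3 * c, 1 / 3, a / (3 * c * d), b / (3 * c * d), ?_, ?_, ?_, ?_⟩ <;>
        field_simp <;> ring
  · refine ⟨3 * b, 0, 1 / 3, c / (3 * b), a / (3 * b * d), ?_, ?_, ?_, ?_⟩ <;>
      field_simp <;> ring
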